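/- Let (Ω,𝓕,P) be a probability space carrying a [0,1]-valued uniformly distributed random variable. For every 𝕂-valued random variable Z on (Ω,𝓕,P) with |Z| integrable and every α ∈ [0,1), there exists E_α ∈ 𝓕 such that P(E_α) = 1 − α and AV@R_α(|Z|) = (1/(1−α)) E(|Z|·1_{E_α}). -/

import Mathlib

open MeasureTheory
open scoped ENNReal NNReal

noncomputable section

variable {Ω : Type*} [MeasurableSpace Ω]

/-- A `[0,1]`-valued random variable uniformly distributed on `[0,1]`:
`P(U ≤ u) = u` for all `u ∈ [0,1]`. -/
def IsUniformRV (P : Measure Ω) (U : Ω → ℝ) : Prop :=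
  Measurable U ∧ (∀ ω, U ω ∈ Set.Icc (0 : ℝ) 1) ∧
    ∀ u ∈ Set.Icc (0 : ℝ) 1, P {ω | U ω ≤ u} = ENNReal.ofReal u

/-- A distortion function: nondecreasing, nonnegative, left-continuous on `[0,1)`
with `∫₀¹ σ(u) du = 1`. -/
structure IsDistortion (σ : ℝ → ℝ) : Prop where
  nonneg : ∀ u ∈ Set.Ico (0 : ℝ) 1, 0 ≤ σ u
  mono : MonotoneOn σ (Set.Ico (0 : ℝ) 1)
  left_continuous : ∀ u ∈ Set.Ioo (0 : ℝ) 1,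
    Filter.Tendsto σ (nhdsWithin u (Set.Iio u)) (nhds (σ u))
  integral_one : ∫ u in Set.Ioo (0 : ℝ) 1, σ u = 1

/-- `‖Y‖_{σ,p}^p := sup over uniform U of E[σ(U)·‖Y‖^p]`. -/
def sigmaPow (P : Measure Ω) (σ : ℝ → ℝ) (p : ℝ) {X : Type*} [NormedAddCommGroup X]
    (Y : Ω → X) : ℝ≥0∞ :=
  ⨆ (U : Ω → ℝ) (_ : IsUniformRV P U),
    ∫⁻ ω, ENNReal.ofReal (σ (U ω)) * (‖Y ω‖₊ : ℝ≥0∞) ^ p ∂P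

/-- The norm `‖Y‖_{σ,p}`. -/
def sigmaNorm (P : Measure Ω) (σ : ℝ → ℝ) (p : ℝ) {X : Type*} [NormedAddCommGroup X]
    (Y : Ω → X) : ℝ≥0∞ :=
  sigmaPow P σ p Y ^ (1 / p)

/-- Membership in `L_σ^p(P,X)`: strongly measurable with finite `σ,p`-norm. -/
def MemLsigma (P : Measure Ω) (σ : ℝ → ℝ) (p : ℝ) {X : Type*} [NormedAddCommGroup X]
    (Y : Ω → X) : Prop :=
  AEStronglyMeasurable Y P ∧ sigmaPow P σ p Y < ∞

/-- The generalized inverse distribution function (quantile function)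
`F_g^{-1}(α) = inf {q : P(g ≤ q) ≥ α}`. -/
def quantileFn (P : Measure Ω) (g : Ω → ℝ) (α : ℝ) : ℝ :=
  sInf {q : ℝ | ENNReal.ofReal α ≤ P {ω | g ω ≤ q}}

variable {𝕂 : Type*} [RCLike 𝕂]

/-- The Köthe dual of `L_σ^p(P)`:
`{Z measurable : Z·Y ∈ L¹(P) for all Y ∈ L_σ^p(P)}`. -/
def KoetheDual (P : Measure Ω) (σ : ℝ → ℝ) (p : ℝ) (Z : Ω → 𝕂) : Prop :=
  AEStronglyMeasurable Z P ∧
    ∀ Y : Ω → 𝕂, MemLsigma P σ p Y → Integrable (fun ω => Z ω * Y ω) P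

/-- The average value-at-risk of level `α` of the (nonnegative) random variable `g`:
`AV@R_α(g) = (1/(1−α)) ∫_α^1 F_g^{-1}(u) du`. -/
def avar (P : Measure Ω) (g : Ω → ℝ) (α : ℝ) : ℝ≥0∞ :=
  ENNReal.ofReal (1 / (1 - α)) *
    ∫⁻ u in Set.Ioo α 1, ENNReal.ofReal (quantileFn P g u)

/-- `Z'` σ-dominates `Z`: there is a uniform `U` with
`AV@R_α(σ(U)·|Z'|) ≥ AV@R_α(|Z|)` for all `α < 1`. -/
def SigmaDominates (P : Measure Ω) (σ : ℝ → ℝ) (Z' Z : Ω → 𝕂) : Prop :=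
  ∃ U : Ω → ℝ, IsUniformRV P U ∧ ∀ α ∈ Set.Ico (0 : ℝ) 1,
    avar P (fun ω => ‖Z ω‖) α ≤ avar P (fun ω => σ (U ω) * ‖Z' ω‖) α

/-- `|Z|*_{σ,∞} = sup_{α ∈ [0,1)} AV@R_α(|Z|) / ((1/(1−α))·S_σ(α))
 = sup_{α ∈ [0,1)} (∫_α^1 F_{|Z|}^{-1}(u) du) / (∫_α^1 σ(u) du)`. -/
def dualNormInf (P : Measure Ω) (σ : ℝ → ℝ) (Z : Ω → 𝕂) : ℝ≥0∞ :=
  ⨆ (α : ℝ) (_ : α ∈ Set.Ico (0 : ℝ) 1),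
    (∫⁻ u in Set.Ioo α 1, ENNReal.ofReal (quantileFn P (fun ω => ‖Z ω‖) u)) /
      ENNReal.ofReal (∫ u in Set.Ioo α 1, σ u)

/-- `|Z|*_{σ,q} = inf {‖Z'‖_{σ,q} : Z' σ-dominates Z}` (with `inf ∅ = ∞`). -/
def dualNormQ (P : Measure Ω) (σ : ℝ → ℝ) (q : ℝ) (Z : Ω → 𝕂) : ℝ≥0∞ :=
  ⨅ (Z' : Ω → 𝕂) (_ : AEStronglyMeasurable Z' P ∧ SigmaDominates P σ Z' Z),
    sigmaNorm P σ q Z'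

section quantile

open Set Filter Topology ProbabilityTheory

/-- If `{f > q} ⊆ S ⊆ {f ≥ q}` up to null sets, then `∫_S f = q m(S) + ∫ (f - q)⁺`. -/
theorem setIntegral_eq_mul_measureReal_add_integral_max {Ω : Type*} [MeasurableSpace Ω]
    {m : Measure Ω} [IsFiniteMeasure m] {f : Ω → ℝ} (hf : Integrable f m) {S : Set Ω}
    (hS : MeasurableSet S) {q : ℝ} (hle : ∀ᵐ ω ∂m, ω ∈ S → q ≤ f ω)
    (hge : ∀ᵐ ω ∂m, ω ∉ S → f ω ≤ q) :
    ∫ ω in S, f ω ∂m = q * m.real S + ∫ ω, max (f ω - q) 0 ∂m := by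
  have hmax : ∫ ω, max (f ω - q) 0 ∂m = ∫ ω, S.indicator (fun ω => f ω - q) ω ∂m := by
    refine integral_congr_ae ?_
    filter_upwards [hle, hge] with ω h₁ h₂
    by_cases h : ω ∈ S
    · simp [h, h₁ h]
    · simp [h, h₂ h]
  rw [hmax, integral_indicator hS, integral_sub hf.integrableOn (integrable_const q)]
  simp [mul_comm]

theorem quantileFn_congr_ae {P : Measure Ω} {f g : Ω → ℝ} (h : f =ᵐ[P] g) :
    quantileFn P f = quantileFn P g := by
  funext u
  have hP : ∀ x, P {ω | f ω ≤ x} = P {ω | g ω ≤ x} := fun x =>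
    measure_congr (by filter_upwards [h] with ω hω; exact congrArg (· ≤ x) hω)
  simp only [quantileFn, hP]

theorem quantileFn_nonneg {P : Measure Ω} {g : Ω → ℝ} (hg₀ : ∀ ω, 0 ≤ g ω) {u : ℝ} (hu : 0 < u) :
    0 ≤ quantileFn P g u := by
  refine Real.sInf_nonneg fun x (hx : ENNReal.ofReal u ≤ _) => ?_
  by_contra! h
  have : {ω | g ω ≤ x} = ∅ := by
    ext ω
    simpa using h.trans_le (hg₀ ω)
  rw [this, measure_empty] at hx
  simp [hu.not_ge] at hx

theorem quantileFn_zero (P : Measure Ω) (g : Ω → ℝ) : quantileFn P g 0 = 0 := by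
  simp [quantileFn]

variable {P : Measure Ω} [IsProbabilityMeasure P] {g : Ω → ℝ}

theorem measure_le_eq_cdf_map (hg : Measurable g) (x : ℝ) :
    P {ω | g ω ≤ x} = ENNReal.ofReal (cdf (P.map g) x) := by
  have := Measure.isProbabilityMeasure_map (μ := P) hg.aemeasurable
  rw [ofReal_cdf, Measure.map_apply hg measurableSet_Iic]
  rfl

theorem quantileFn_eq_sInf_cdf (hg : Measurable g) (u : ℝ) :
    quantileFn P g u = sInf {x | u ≤ cdf (P.map g) x} := by
  simp only [quantileFn, measure_le_eq_cdf_map hg,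
    ENNReal.ofReal_le_ofReal_iff (cdf_nonneg _ _)]

theorem quantileFn_le_iff (hg : Measurable g) {u : ℝ} (hu : u ∈ Ioo (0 : ℝ) 1) (x : ℝ) :
    quantileFn P g u ≤ x ↔ u ≤ cdf (P.map g) x := by
  rw [quantileFn_eq_sInf_cdf hg]
  obtain ⟨y₁, hy₁⟩ := ((tendsto_cdf_atTop (P.map g)).eventually_const_lt hu.2).exists
  obtain ⟨y₀, hy₀⟩ := ((tendsto_cdf_atBot (P.map g)).eventually_lt_const hu.1).exists
  have hbdd : BddBelow {x | u ≤ cdf (P.map g) x} := by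
    refine ⟨y₀, fun y hy => ?_⟩
    by_contra! h
    exact absurd (hy.trans (monotone_cdf _ h.le)) hy₀.not_ge
  refine ⟨fun h => ?_, fun h => csInf_le hbdd h⟩
  have hright : Tendsto (cdf (P.map g)) (𝓝[>] x) (𝓝 (cdf (P.map g) x)) :=
    ((cdf (P.map g)).right_continuous x).mono_left (nhdsWithin_mono _ Ioi_subset_Ici_self)
  refine ge_of_tendsto hright ?_
  filter_upwards [self_mem_nhdsWithin] with y hy
  obtain ⟨z, hz, hzy⟩ := exists_lt_of_csInf_lt ⟨y₁, hy₁.le⟩ (h.trans_lt hy)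
  exact le_trans hz (monotone_cdf _ hzy.le)

theorem monotoneOn_quantileFn (hg : Measurable g) :
    MonotoneOn (quantileFn P g) (Ioo 0 1) := fun _ hu _ hv huv =>
  (quantileFn_le_iff hg hu _).2 (huv.trans ((quantileFn_le_iff hg hv _).1 le_rfl))

theorem aemeasurable_quantileFn (hg : Measurable g) :
    AEMeasurable (quantileFn P g) (volume.restrict (Ioo 0 1)) :=
  aemeasurable_restrict_of_monotoneOn measurableSet_Ioo (monotoneOn_quantileFn hg)

theorem isProbabilityMeasure_restrict_Ioo_zero_one :
    IsProbabilityMeasure (volume.restrict (Ioo (0 : ℝ) 1)) :=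
  ⟨by simp⟩

theorem map_quantileFn (hg : Measurable g) :
    (volume.restrict (Ioo 0 1)).map (quantileFn P g) = P.map g := by
  have := isProbabilityMeasure_restrict_Ioo_zero_one
  have := Measure.isProbabilityMeasure_map (μ := P) hg.aemeasurable
  have := Measure.isProbabilityMeasure_map (aemeasurable_quantileFn (P := P) hg)
  refine Measure.ext_of_Iic _ _ fun x => ?_
  have hset : quantileFn P g ⁻¹' Iic x ∩ Ioo 0 1
      = Iic (cdf (P.map g) x) ∩ Ioo 0 1 := by
    ext u
    simp only [mem_inter_iff, mem_preimage, mem_Iic]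
    exact and_congr_left fun hu => quantileFn_le_iff hg hu x
  rw [Measure.map_apply_of_aemeasurable (aemeasurable_quantileFn hg) measurableSet_Iic,
    Measure.restrict_apply' measurableSet_Ioo, hset, ← ofReal_cdf (P.map g)]
  have hae : (Iic (cdf (P.map g) x) ∩ Ioo 0 1 : Set ℝ) =ᵐ[volume]
      (Iic (cdf (P.map g) x) ∩ Ioc 0 1 : Set ℝ) := ae_eq_rfl.inter Ioo_ae_eq_Ioc
  have hIoc : Iic (cdf (P.map g) x) ∩ Ioc (0 : ℝ) 1 = Ioc 0 (cdf (P.map g) x) := by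
    ext u
    have := cdf_le_one (P.map g) x
    simp only [mem_inter_iff, mem_Iic, mem_Ioc]
    grind
  rw [measure_congr hae, hIoc, Real.volume_Ioc, sub_zero]

theorem measure_quantileFn_lt_le (hg : Measurable g) {α : ℝ} (hα : α ∈ Ico (0 : ℝ) 1) :
    P {ω | quantileFn P g α < g ω} ≤ ENNReal.ofReal (1 - α) := by
  have hcompl : {ω | quantileFn P g α < g ω} = (g ⁻¹' Iic (quantileFn P g α))ᶜ := by
    ext; simp
  have := Measure.isProbabilityMeasure_map (μ := P) hg.aemeasurable
  rw [hcompl, prob_compl_eq_one_sub (hg measurableSet_Iic), ENNReal.ofReal_sub _ hα.1,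
    ENNReal.ofReal_one, ← Measure.map_apply hg measurableSet_Iic, ← ofReal_cdf (P.map g)]
  gcongr
  rcases hα.1.eq_or_lt with rfl | h
  · exact cdf_nonneg _ _
  · exact (quantileFn_le_iff hg ⟨h, hα.2⟩ _).1 le_rfl

theorem le_measure_quantileFn_le (hg : Measurable g) (hg₀ : ∀ ω, 0 ≤ g ω) {α : ℝ}
    (hα : α ∈ Ico (0 : ℝ) 1) :
    ENNReal.ofReal (1 - α) ≤ P {ω | quantileFn P g α ≤ g ω} := by
  rcases hα.1.eq_or_lt with rfl | h
  · simp [quantileFn_zero, hg₀]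
  have := Measure.isProbabilityMeasure_map (μ := P) hg.aemeasurable
  have hcompl : {ω | quantileFn P g α ≤ g ω} = (g ⁻¹' Iio (quantileFn P g α))ᶜ := by
    ext; simp
  rw [hcompl, prob_compl_eq_one_sub (hg measurableSet_Iio), ENNReal.ofReal_sub _ hα.1,
    ENNReal.ofReal_one, ← Measure.map_apply hg measurableSet_Iio, ← measure_cdf (P.map g),
    StieltjesFunction.measure_Iio _ (tendsto_cdf_atBot _), sub_zero]
  gcongr
  refine le_of_tendsto ((monotone_cdf (P.map g)).tendsto_leftLim _) ?_
  filter_upwards [self_mem_nhdsWithin] with y (hy : y < _)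
  by_contra! hlt
  exact hy.not_ge ((quantileFn_le_iff hg ⟨h, hα.2⟩ y).2 hlt.le)

theorem IsUniformRV.measure_Ioc {U : Ω → ℝ} (hU : IsUniformRV P U) {s t : ℝ}
    (hs : s ∈ Icc (0 : ℝ) 1) (ht : t ∈ Icc (0 : ℝ) 1) :
    P (U ⁻¹' Ioc s t) = ENNReal.ofReal (t - s) := by
  have hdiff : U ⁻¹' Ioc s t = {ω | U ω ≤ t} \ {ω | U ω ≤ s} := by
    ext; simp [and_comm]
  rcases le_total s t with hst | hst
  · rw [hdiff, measure_sdiff (show {ω | U ω ≤ s} ⊆ {ω | U ω ≤ t} from fun ω h => le_trans h hst)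
      (hU.1 measurableSet_Iic).nullMeasurableSet (measure_ne_top _ _), hU.2.2 s hs, hU.2.2 t ht,
      ENNReal.ofReal_sub _ hs.1]
  · simp [hst]

/-- A space carrying a uniform random variable has the Darboux property: every value between the
probabilities of nested events is attained by an event in between. -/
theorem IsUniformRV.exists_measurableSet_between {U : Ω → ℝ} (hU : IsUniformRV P U)
    {A B : Set Ω} (hA : MeasurableSet A) (hB : MeasurableSet B) (hAB : A ⊆ B) {c : ℝ≥0∞}
    (hAc : P A ≤ c) (hcB : c ≤ P B) :
    ∃ E, MeasurableSet E ∧ A ⊆ E ∧ E ⊆ B ∧ P E = c := by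
  set G : ℝ → Set Ω := fun t => A ∪ B ∩ {ω | U ω ≤ t}
  have hGm : ∀ t, MeasurableSet (G t) := fun t => hA.union (hB.inter (hU.1 measurableSet_Iic))
  have hmono : Monotone G := fun s t hst =>
    union_subset_union_right _ (inter_subset_inter_right _ fun ω (h : _ ≤ _) => h.trans hst)
  have hstep : ∀ s ∈ Icc (0 : ℝ) 1, ∀ t ∈ Icc (0 : ℝ) 1, s ≤ t →
      P.real (G t) ≤ P.real (G s) + (t - s) := by
    intro s hs t ht hst
    have hsub : G t ⊆ G s ∪ U ⁻¹' Ioc s t := by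
      rintro ω (h | ⟨h₁, h₂⟩)
      · exact Or.inl (Or.inl h)
      · by_cases h : U ω ≤ s
        · exact Or.inl (Or.inr ⟨h₁, h⟩)
        · exact Or.inr ⟨not_le.1 h, h₂⟩
    refine (measureReal_mono hsub).trans ((measureReal_union_le _ _).trans_eq ?_)
    rw [measureReal_def P (U ⁻¹' _), hU.measure_Ioc hs ht,
      ENNReal.toReal_ofReal (sub_nonneg.2 hst)]
  have hcont : ContinuousOn (fun t => P.real (G t)) (Icc 0 1) := by
    refine LipschitzOnWith.continuousOn (K := 1) (LipschitzOnWith.of_dist_le_mul ?_)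
    intro s hs t ht
    rw [Real.dist_eq, Real.dist_eq, NNReal.coe_one, one_mul]
    rcases le_total s t with hst | hst
    · have h₁ := hstep s hs t ht hst
      have h₂ : P.real (G s) ≤ P.real (G t) := measureReal_mono (hmono hst)
      rw [abs_le, abs_of_nonpos (by linarith : s - t ≤ 0)]
      constructor <;> linarith
    · have h₁ := hstep t ht s hs hst
      have h₂ : P.real (G t) ≤ P.real (G s) := measureReal_mono (hmono hst)
      rw [abs_le, abs_of_nonneg (by linarith : 0 ≤ s - t)]
      constructor <;> linarith
  have hc : c ≠ ∞ := ne_top_of_le_ne_top (measure_ne_top _ _) hcB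
  have h0 : P.real (G 0) ≤ c.toReal := by
    refine ENNReal.toReal_mono hc (le_trans ?_ hAc)
    have hnull : P {ω | U ω ≤ 0} = 0 := by simpa using hU.2.2 0 (by simp)
    refine (measure_union_le _ _).trans_eq ?_
    rw [measure_inter_null_of_null_right _ hnull, add_zero]
  have h1 : c.toReal ≤ P.real (G 1) := by
    refine ENNReal.toReal_mono (measure_ne_top _ _) (hcB.trans (measure_mono fun ω h => ?_))
    exact Or.inr ⟨h, (hU.2.1 ω).2⟩
  obtain ⟨t, -, ht⟩ := intermediate_value_Icc zero_le_one hcont ⟨h0, h1⟩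
  exact ⟨G t, hGm t, subset_union_left, union_subset hAB inter_subset_left,
    (ENNReal.toReal_eq_toReal_iff' (measure_ne_top _ _) hc).1 ht⟩

theorem setIntegral_quantileFn_eq (hg : Measurable g) (hg₀ : ∀ ω, 0 ≤ g ω)
    (hint : Integrable g P) {α : ℝ} (hα : α ∈ Ico (0 : ℝ) 1) {E : Set Ω} (hE : MeasurableSet E)
    (hPE : P E = ENNReal.ofReal (1 - α)) (hlt : {ω | quantileFn P g α < g ω} ⊆ E)
    (hle : E ⊆ {ω | quantileFn P g α ≤ g ω}) :
    ∫ u in Ioo α 1, quantileFn P g u = ∫ ω in E, g ω ∂P := by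
  have := isProbabilityMeasure_restrict_Ioo_zero_one
  have hQ := aemeasurable_quantileFn (P := P) hg
  have hQint : Integrable (quantileFn P g) (volume.restrict (Ioo 0 1)) := by
    have h : Integrable id ((volume.restrict (Ioo 0 1)).map (quantileFn P g)) := by
      rw [map_quantileFn hg]
      exact (integrable_map_measure aestronglyMeasurable_id hg.aemeasurable).2 hint
    exact (integrable_map_measure aestronglyMeasurable_id hQ).1 h
  have hsub : Ioo α 1 ⊆ Ioo (0 : ℝ) 1 := Ioo_subset_Ioo_left hα.1
  have hleft := setIntegral_eq_mul_measureReal_add_integral_max hQint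
    (measurableSet_Ioo (a := α) (b := 1)) (q := quantileFn P g α)
    (Eventually.of_forall fun u hu => by
      rcases hα.1.eq_or_lt with rfl | h
      · rw [quantileFn_zero]
        exact quantileFn_nonneg hg₀ hu.1
      · exact monotoneOn_quantileFn hg ⟨h, hα.2⟩ (hsub hu) hu.1.le)
    (by
      filter_upwards [ae_restrict_mem measurableSet_Ioo] with u hu hu'
      have huα : u ≤ α := by
        by_contra! h
        exact hu' ⟨h, hu.2⟩
      exact monotoneOn_quantileFn hg hu ⟨hu.1.trans_le huα, hα.2⟩ huα)
  have hright := setIntegral_eq_mul_measureReal_add_integral_max hint hE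
    (q := quantileFn P g α) (Eventually.of_forall fun ω h => hle h)
    (Eventually.of_forall fun ω h => not_lt.1 fun h' => h (hlt h'))
  have hmeas : (volume.restrict (Ioo (0 : ℝ) 1)).real (Ioo α 1) = P.real E := by
    rw [measureReal_def, measureReal_def, hPE, Measure.restrict_apply measurableSet_Ioo,
      inter_eq_left.2 hsub, Real.volume_Ioo]
  have hφ : Measurable fun x : ℝ => max (x - quantileFn P g α) 0 := by fun_prop
  have hmax : ∫ u in Ioo 0 1, max (quantileFn P g u - quantileFn P g α) 0
      = ∫ ω, max (g ω - quantileFn P g α) 0 ∂P := by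
    rw [← integral_map hQ hφ.aestronglyMeasurable, map_quantileFn hg,
      integral_map hg.aemeasurable hφ.aestronglyMeasurable]
  rw [Measure.restrict_restrict measurableSet_Ioo, inter_eq_left.2 hsub] at hleft
  rw [hleft, hright, hmeas, hmax]

end quantile

/-- For an integrable `𝕂`-valued `Z` and `α ∈ [0,1)` there is a
measurable set `E_α` with `P(E_α) = 1−α` and
`AV@R_α(|Z|) = (1/(1−α))·E(|Z|·1_{E_α})`. -/
theorem statement12
    (P : Measure Ω) [IsProbabilityMeasure P]
    (hrich : ∃ U : Ω → ℝ, IsUniformRV P U)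
    {𝕂 : Type*} [RCLike 𝕂]
    (Z : Ω → 𝕂) (hZ : Integrable Z P) (α : ℝ) (hα : α ∈ Set.Ico (0 : ℝ) 1) :
    ∃ E : Set Ω, MeasurableSet E ∧ P E = ENNReal.ofReal (1 - α) ∧
      (1 / (1 - α)) * ∫ u in Set.Ioo α 1, quantileFn P (fun ω => ‖Z ω‖) u
        = (1 / (1 - α)) * ∫ ω in E, ‖Z ω‖ ∂P := by
  obtain ⟨U, hU⟩ := hrich
  set g : Ω → ℝ := fun ω => ‖hZ.aestronglyMeasurable.mk Z ω‖
  have hg : Measurable g := hZ.aestronglyMeasurable.stronglyMeasurable_mk.norm.measurable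
  have hg₀ : ∀ ω, 0 ≤ g ω := fun ω => norm_nonneg _
  have hae : (fun ω => ‖Z ω‖) =ᵐ[P] g := hZ.aestronglyMeasurable.ae_eq_mk.fun_comp _
  obtain ⟨E, hE, hlt, hle, hPE⟩ := hU.exists_measurableSet_between
    (hg measurableSet_Ioi : MeasurableSet {ω | quantileFn P g α < g ω})
    (hg measurableSet_Ici : MeasurableSet {ω | quantileFn P g α ≤ g ω})
    (Set.preimage_mono Set.Ioi_subset_Ici_self) (measure_quantileFn_lt_le hg hα)
    (le_measure_quantileFn_le hg hg₀ hα)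
  refine ⟨E, hE, hPE, ?_⟩
  rw [quantileFn_congr_ae hae, integral_congr_ae (ae_restrict_of_ae hae),
    setIntegral_quantileFn_eq hg hg₀ (hZ.norm.congr hae) hα hE hPE hlt hle]

end
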